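/- arXiv:1603.01379 — 3 statements merged into one kernel-verified Lean document; each statement's English description precedes it below -/
import Mathlib

section
/- Let n ≥ 1 and let ℍⁿ₊ = {(x, y, t) ∈ ℝⁿ × ℝⁿ × ℝ : t > 0}. The constant 1 in the Hardy inequality ∫_{ℍⁿ₊} |∇_{ℍⁿ} u|² dξ ≥ ∫_{ℍⁿ₊} ((|x|² + |y|²)/t²)|u|² dξ is sharp: for every ε > 0 there exists a nonzero u ∈ C_0^∞(ℍⁿ₊) such that ∫_{ℍⁿ₊} |∇_{ℍⁿ} u|² dξ < (1 + ε) ∫_{ℍⁿ₊} ((|x|² + |y|²)/t²)|u|² dξ. -/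
open MeasureTheory RealInnerProductSpace

noncomputable section

/-- The Heisenberg group `ℍⁿ`, identified with Euclidean `ℝ^{2n+1}`;
coordinates `0,…,n-1` are `x`, `n,…,2n-1` are `y`, and `2n` is `t`. -/
abbrev Heis (n : ℕ) := EuclideanSpace ℝ (Fin (2 * n + 1))

/-- Index of the coordinate `x_i`. -/
def xIdx {n : ℕ} (i : Fin n) : Fin (2 * n + 1) := ⟨i.1, by have := i.2; omega⟩

/-- Index of the coordinate `y_i`. -/
def yIdx {n : ℕ} (i : Fin n) : Fin (2 * n + 1) := ⟨n + i.1, by have := i.2; omega⟩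

/-- Index of the coordinate `t`. -/
def tIdx (n : ℕ) : Fin (2 * n + 1) := ⟨2 * n, by omega⟩

/-- The horizontal vector field `X_i = ∂/∂x_i + 2 y_i ∂/∂t` acting on a function. -/
def Xd {n : ℕ} (i : Fin n) (u : Heis n → ℝ) (ξ : Heis n) : ℝ :=
  fderiv ℝ u ξ (EuclideanSpace.single (xIdx i) 1)
    + 2 * ξ (yIdx i) * fderiv ℝ u ξ (EuclideanSpace.single (tIdx n) 1)

/-- The horizontal vector field `Y_i = ∂/∂y_i − 2 x_i ∂/∂t` acting on a function. -/
def Yd {n : ℕ} (i : Fin n) (u : Heis n → ℝ) (ξ : Heis n) : ℝ :=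
  fderiv ℝ u ξ (EuclideanSpace.single (yIdx i) 1)
    - 2 * ξ (xIdx i) * fderiv ℝ u ξ (EuclideanSpace.single (tIdx n) 1)

/-- `|∇_{ℍⁿ} u|² = Σ_i (X_i u)² + (Y_i u)²`. -/
def gradH2 {n : ℕ} (u : Heis n → ℝ) (ξ : Heis n) : ℝ :=
  ∑ i : Fin n, ((Xd i u ξ) ^ 2 + (Yd i u ξ) ^ 2)

/-- `⟨X_i(ξ), ν⟩ = ν_{x_i} + 2 y_i ν_t`. -/
def XiNu {n : ℕ} (i : Fin n) (ξ ν : Heis n) : ℝ := ν (xIdx i) + 2 * ξ (yIdx i) * ν (tIdx n)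

/-- `⟨Y_i(ξ), ν⟩ = ν_{y_i} − 2 x_i ν_t`. -/
def YiNu {n : ℕ} (i : Fin n) (ξ ν : Heis n) : ℝ := ν (yIdx i) - 2 * ξ (xIdx i) * ν (tIdx n)

/-- The function `√t * h (log t)` on `(0, ∞)`, extended by zero: the logarithmic change of
variables `t = exp s` that turns the one-dimensional Hardy quotient of the result into that
of `h` and its derivative on the line. -/
def logLift (h : ℝ → ℝ) (t : ℝ) : ℝ := √t * h (Real.log t)

lemma logLift_eq_zero {h : ℝ → ℝ} {b : ℝ} (hb : ∀ s, b < |s| → h s = 0) {t : ℝ}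
    (ht : t ∉ Set.Icc (Real.exp (-b)) (Real.exp b)) : logLift h t = 0 := by
  unfold logLift
  rcases le_or_gt t 0 with h0 | h0
  · simp [Real.sqrt_eq_zero_of_nonpos h0]
  · rw [hb _ ?_, mul_zero]
    by_contra! hle
    rw [abs_le, Real.le_log_iff_exp_le h0, Real.log_le_iff_le_exp h0] at hle
    exact ht hle

lemma hasDerivAt_logLift {h : ℝ → ℝ} (hh : Differentiable ℝ h) {t : ℝ} (ht : 0 < t) :
    HasDerivAt (logLift h) ((h (Real.log t) / 2 + deriv h (Real.log t)) / √t) t := by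
  have h1 := (Real.hasDerivAt_sqrt ht.ne').mul
    ((hh (Real.log t)).hasDerivAt.comp t (Real.hasDerivAt_log ht.ne'))
  convert! h1 using 1
  have hs : √t ≠ 0 := (Real.sqrt_pos.2 ht).ne'
  have hq : t = √t * √t := (Real.mul_self_sqrt ht.le).symm
  simp only [Function.comp]
  generalize Real.log t = L at *
  generalize √t = r at *
  subst hq
  field_simp

lemma contDiff_logLift {h : ℝ → ℝ} (hh : ContDiff ℝ (⊤ : ℕ∞) h) {b : ℝ}
    (hb : ∀ s, b < |s| → h s = 0) : ContDiff ℝ (⊤ : ℕ∞) (logLift h) := by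
  rw [contDiff_iff_contDiffAt]
  intro t
  rcases le_or_gt t 0 with h0 | h0
  · refine contDiffAt_const (c := (0 : ℝ)) |>.congr_of_eventuallyEq ?_
    filter_upwards [Iio_mem_nhds (h0.trans_lt (Real.exp_pos (-b)))] with x hx
    exact logLift_eq_zero hb fun hx' => absurd hx'.1 (not_le.2 hx)
  · exact (Real.contDiffAt_sqrt h0.ne').mul
      (hh.contDiffAt.comp t (Real.contDiffAt_log.2 h0.ne'))

lemma integral_eq_integral_exp {F : ℝ → ℝ} (hF : ∀ t ≤ 0, F t = 0) :
    ∫ t, F t = ∫ s, Real.exp s * F (Real.exp s) := by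
  have h1 := integral_image_eq_integral_abs_deriv_smul (s := Set.univ) (f := Real.exp)
    (f' := Real.exp) MeasurableSet.univ (fun x _ => (Real.hasDerivAt_exp x).hasDerivWithinAt)
    Real.exp_injective.injOn F
  rw [Set.image_univ, Real.range_exp, setIntegral_univ,
    setIntegral_eq_integral_of_forall_compl_eq_zero
      (fun x hx => hF x (by simpa using hx))] at h1
  simpa [abs_of_pos (Real.exp_pos _)] using h1

lemma HasCompactSupport.sq {X : Type*} [TopologicalSpace X] {f : X → ℝ}
    (hf : HasCompactSupport f) : HasCompactSupport fun x => f x ^ 2 :=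
  hf.comp_left (g := fun y => y ^ 2) (by simp)

lemma integral_mul_deriv_self_eq_zero {h : ℝ → ℝ} (hh : ContDiff ℝ (⊤ : ℕ∞) h)
    (hc : HasCompactSupport h) : ∫ s, h s * deriv h s = 0 := by
  have hd : Continuous (deriv h) := hh.continuous_deriv (by simp)
  have h1 := integral_eq_zero_of_hasDerivAt_of_integrable (f := fun s => h s ^ 2)
    (f' := fun s => 2 * (h s * deriv h s))
    (fun s => by
      have := ((hh.differentiable (by simp) s).hasDerivAt.pow 2)
      convert! this using 1
      push_cast; ring)
    ((hh.continuous.mul hd).integrable_of_hasCompactSupport (hc.mul_right) |>.const_mul 2)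
    ((hh.continuous.pow 2).integrable_of_hasCompactSupport hc.sq)
  rw [integral_const_mul] at h1
  linarith

lemma integral_logLift_sq_div {h : ℝ → ℝ} :
    ∫ t, logLift h t ^ 2 / t ^ 2 = ∫ s, h s ^ 2 := by
  rw [integral_eq_integral_exp fun t ht => by simp [logLift, Real.sqrt_eq_zero_of_nonpos ht]]
  congr 1 with s
  have := Real.exp_pos s
  rw [logLift, mul_pow, Real.sq_sqrt this.le, Real.log_exp]
  field_simp

lemma integral_deriv_logLift_sq {h : ℝ → ℝ} (hh : ContDiff ℝ (⊤ : ℕ∞) h)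
    (hc : HasCompactSupport h) {b : ℝ} (hb : ∀ s, b < |s| → h s = 0) :
    4 * ∫ t, deriv (logLift h) t ^ 2 = (∫ s, h s ^ 2) + 4 * ∫ s, deriv h s ^ 2 := by
  have hd : Continuous (deriv h) := hh.continuous_deriv (by simp)
  have hi0 : Integrable fun s => h s ^ 2 :=
    (hh.continuous.pow 2).integrable_of_hasCompactSupport hc.sq
  have hi1 : Integrable fun s => h s * deriv h s :=
    (hh.continuous.mul hd).integrable_of_hasCompactSupport hc.mul_right
  have hi2 : Integrable fun s => deriv h s ^ 2 :=
    (hd.pow 2).integrable_of_hasCompactSupport hc.deriv.sq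
  rw [integral_eq_integral_exp fun t ht => ?_]
  · have : ∀ s, Real.exp s * deriv (logLift h) (Real.exp s) ^ 2 =
        (h s ^ 2 / 4 + h s * deriv h s) + deriv h s ^ 2 := fun s => by
      have hs := Real.exp_pos s
      rw [(hasDerivAt_logLift (hh.differentiable (by simp)) hs).deriv, div_pow,
        Real.sq_sqrt hs.le, Real.log_exp]
      field_simp
      ring
    simp_rw [this]
    have hi01 : Integrable fun s => h s ^ 2 / 4 + h s * deriv h s := (hi0.div_const 4).add hi1
    rw [integral_add hi01 hi2, integral_add (hi0.div_const 4) hi1,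
      integral_mul_deriv_self_eq_zero hh hc, integral_div]
    ring
  · have : logLift h =ᶠ[nhds t] fun _ => (0 : ℝ) := by
      filter_upwards [Iio_mem_nhds (ht.trans_lt (Real.exp_pos (-b)))] with x hx
      exact logLift_eq_zero hb fun hx' => absurd hx'.1 (not_le.2 hx)
    rw [this.deriv_eq]
    simp

/-- A smooth cutoff equal to `1` on `(-∞, 1]` and to `0` on `[2, ∞)`. -/
def cutoff (s : ℝ) : ℝ := Real.smoothTransition (2 - s)

lemma contDiff_cutoff : ContDiff ℝ (⊤ : ℕ∞) cutoff :=
  Real.smoothTransition.contDiff.comp (contDiff_const.sub contDiff_id)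

lemma cutoff_of_le {s : ℝ} (hs : s ≤ 1) : cutoff s = 1 :=
  Real.smoothTransition.one_of_one_le (by linarith)

lemma cutoff_of_ge {s : ℝ} (hs : 2 ≤ s) : cutoff s = 0 :=
  Real.smoothTransition.zero_of_nonpos (by linarith)

/-- The constant `1 / 4` in the one-dimensional Hardy inequality cannot be improved. -/
lemma exists_hardy_almost_minimizer {ε : ℝ} (hε : 0 < ε) :
    ∃ g : ℝ → ℝ, ContDiff ℝ (⊤ : ℕ∞) g ∧
      (∃ a b, 0 < a ∧ ∀ t, t ∉ Set.Icc a b → g t = 0) ∧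
      4 * ∫ t, deriv g t ^ 2 < (1 + ε) * ∫ t, g t ^ 2 / t ^ 2 := by
  set k : ℝ → ℝ := fun s => cutoff (s ^ 2) with hk
  have hks : ContDiff ℝ (⊤ : ℕ∞) k := contDiff_cutoff.comp (contDiff_id.pow 2)
  have hk0 : ∀ s, 2 < |s| → k s = 0 := fun s hs => cutoff_of_ge (by
    rw [← sq_abs]; nlinarith)
  have hkc : HasCompactSupport k :=
    HasCompactSupport.intro (isCompact_Icc (a := (-2 : ℝ)) (b := 2)) fun s hs =>
      hk0 s (by
        by_contra! hle
        exact hs (abs_le.1 hle))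
  have hpos : 0 < ∫ s, k s ^ 2 :=
    (hks.continuous.pow 2).integral_pos_of_hasCompactSupport_nonneg_nonzero (x := 0)
      hkc.sq (fun s => sq_nonneg _)
      (by simp [hk, cutoff_of_le])
  set C0 := ∫ s, k s ^ 2
  set C1 := ∫ s, deriv k s ^ 2
  obtain ⟨δ, hδ, hδlt⟩ : ∃ δ : ℝ, 0 < δ ∧ 4 * δ ^ 2 * C1 < ε * C0 := by
    have h1 : Filter.Tendsto (fun δ : ℝ => 4 * δ ^ 2 * C1) (nhdsWithin 0 (Set.Ioi 0))
        (nhds (4 * 0 ^ 2 * C1)) :=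
      (Continuous.tendsto (by fun_prop) 0).mono_left nhdsWithin_le_nhds
    have h2 := h1.eventually_lt_const (u := ε * C0) (by
      have := mul_pos hε hpos
      simpa using this)
    obtain ⟨δ, h3, h4⟩ := (h2.and self_mem_nhdsWithin).exists
    exact ⟨δ, h4, h3⟩
  set h : ℝ → ℝ := fun s => k (δ * s) with hh
  have hhs : ContDiff ℝ (⊤ : ℕ∞) h := hks.comp (contDiff_const.mul contDiff_id)
  have hb : ∀ s, 2 / δ < |s| → h s = 0 := fun s hs => hk0 _ (by
    rw [abs_mul, abs_of_pos hδ]; rwa [div_lt_iff₀' hδ] at hs)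
  have hhc : HasCompactSupport h :=
    HasCompactSupport.intro (isCompact_Icc (a := -(2 / δ)) (b := 2 / δ)) fun s hs =>
      hb s (by
        by_contra! hle
        exact hs (abs_le.1 hle))
  have hI0 : ∫ s, h s ^ 2 = δ⁻¹ * C0 := by
    have := Measure.integral_comp_mul_left (fun s => k s ^ 2) δ
    simpa [abs_of_pos hδ] using this
  have hI1 : ∫ s, deriv h s ^ 2 = δ ^ 2 * (δ⁻¹ * C1) := by
    have := Measure.integral_comp_mul_left (fun s => deriv k s ^ 2) δ
    simp only [abs_of_pos (inv_pos.2 hδ), smul_eq_mul] at this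
    rw [← this, ← integral_const_mul]
    congr 1 with s
    rw [hh, deriv_comp_mul_left, smul_eq_mul, mul_pow]
  refine ⟨logLift h, contDiff_logLift hhs hb,
    ⟨_, _, Real.exp_pos _, fun t => logLift_eq_zero hb⟩, ?_⟩
  rw [integral_deriv_logLift_sq hhs hhc hb, integral_logLift_sq_div, hI0, hI1]
  have : δ⁻¹ * (4 * δ ^ 2 * C1) < δ⁻¹ * (ε * C0) := by gcongr
  linarith

/-- The squared length `|x|² + |y|²` of the horizontal part `z = (x, y)`. -/
def horizSq {n : ℕ} (z : Fin (2 * n) → ℝ) : ℝ :=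
  ∑ i : Fin n, ((z ⟨i.1, by have := i.2; omega⟩) ^ 2 + (z ⟨n + i.1, by have := i.2; omega⟩) ^ 2)

lemma horizSq_nonneg {n : ℕ} (z : Fin (2 * n) → ℝ) : 0 ≤ horizSq z :=
  Finset.sum_nonneg fun _ _ => by positivity

lemma continuous_horizSq {n : ℕ} : Continuous (horizSq (n := n)) := by
  unfold horizSq
  fun_prop

lemma horizSq_smul {n : ℕ} (r : ℝ) (z : Fin (2 * n) → ℝ) :
    horizSq (r • z) = r ^ 2 * horizSq z := by
  simp only [horizSq, Finset.mul_sum, Pi.smul_apply, smul_eq_mul]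
  exact Finset.sum_congr rfl fun _ _ => by ring

lemma sq_le_horizSq {n : ℕ} (z : Fin (2 * n) → ℝ) (j : Fin (2 * n)) : z j ^ 2 ≤ horizSq z := by
  have key (i : Fin n) := Finset.single_le_sum
    (f := fun i : Fin n => (z ⟨i.1, by have := i.2; omega⟩) ^ 2 +
      (z ⟨n + i.1, by have := i.2; omega⟩) ^ 2)
    (fun _ _ => by positivity) (Finset.mem_univ i)
  rcases lt_or_ge j.1 n with hj | hj
  · refine le_trans ?_ (key ⟨j.1, hj⟩)
    simpa using sq_nonneg _
  · refine le_trans ?_ (key ⟨j.1 - n, by have := j.2; omega⟩)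
    have : (⟨n + (j.1 - n), by have := j.2; omega⟩ : Fin (2 * n)) = j := Fin.ext (by simp; omega)
    simp only [this]
    linarith [sq_nonneg (z ⟨j.1 - n, by have := j.2; omega⟩)]

lemma abs_le_of_horizSq_le {n : ℕ} {z : Fin (2 * n) → ℝ} {C : ℝ} (h : horizSq z ≤ C)
    (j : Fin (2 * n)) : |z j| ≤ √C :=
  Real.abs_le_sqrt ((sq_le_horizSq z j).trans h)

lemma hasCompactSupport_comp_horizSq {n : ℕ} {F : ℝ → ℝ} {C : ℝ} (hF : ∀ s, C < s → F s = 0) :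
    HasCompactSupport fun z : Fin (2 * n) → ℝ => F (horizSq z) := by
  refine HasCompactSupport.intro
    (isCompact_univ_pi fun _ : Fin (2 * n) => isCompact_Icc (a := -√C) (b := √C)) fun z hz => hF _ ?_
  by_contra! hle
  exact hz fun j _ => abs_le.1 (abs_le_of_horizSq_le hle j)

lemma deriv_eq_zero_of_forall_gt {F : ℝ → ℝ} {C : ℝ} (hF : ∀ s, C < s → F s = 0) {s : ℝ}
    (hs : C < s) : deriv F s = 0 := by
  have : F =ᶠ[nhds s] fun _ => (0 : ℝ) := by
    filter_upwards [Ioi_mem_nhds hs] with x hx using hF x hx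
  rw [this.deriv_eq, deriv_const]

lemma integrable_horizSq_mul_sq {n : ℕ} {F : ℝ → ℝ} {C : ℝ} (hc : Continuous F)
    (hF : ∀ s, C < s → F s = 0) :
    Integrable fun z : Fin (2 * n) → ℝ => horizSq z * F (horizSq z) ^ 2 := by
  have h1 : Continuous fun z : Fin (2 * n) → ℝ => horizSq z * F (horizSq z) ^ 2 :=
    continuous_horizSq.mul ((hc.comp continuous_horizSq).pow 2)
  have h2 : HasCompactSupport fun z : Fin (2 * n) → ℝ => horizSq z * F (horizSq z) ^ 2 :=
    hasCompactSupport_comp_horizSq (F := fun s => s * F s ^ 2) (C := C)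
      fun s hs => by simp [hF s hs]
  exact h1.integrable_of_hasCompactSupport h2

lemma integral_horizSq_comp_smul {n : ℕ} (W : ℝ → ℝ) {r : ℝ} (hr : 0 < r) :
    ∫ z : Fin (2 * n) → ℝ, W (r ^ 2 * horizSq z) =
      (r ^ (2 * n))⁻¹ * ∫ z : Fin (2 * n) → ℝ, W (horizSq z) := by
  have := Measure.integral_comp_smul (volume : Measure (Fin (2 * n) → ℝ))
    (fun z => W (horizSq z)) r
  simp only [horizSq_smul, Module.finrank_fin_fun, smul_eq_mul] at this
  rwa [abs_of_pos (by positivity)] at this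

/-- Flat radial profiles have a small Dirichlet energy relative to their second moment. -/
lemma exists_flat_radial_profile {n : ℕ} (hn : 1 ≤ n) {η : ℝ} (hη : 0 < η) :
    ∃ ρ : ℝ → ℝ, ContDiff ℝ (⊤ : ℕ∞) ρ ∧ (∃ C, ∀ s, C < s → ρ s = 0) ∧
      4 * ∫ z : Fin (2 * n) → ℝ, horizSq z * deriv ρ (horizSq z) ^ 2 <
        η * ∫ z : Fin (2 * n) → ℝ, horizSq z * ρ (horizSq z) ^ 2 := by
  have hpos : 0 < ∫ z : Fin (2 * n) → ℝ, horizSq z * cutoff (horizSq z) ^ 2 := by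
    have hn' : (0 : ℝ) < n := by exact_mod_cast hn
    have h1 : horizSq (fun _ : Fin (2 * n) => √(1 / (2 * n))) = 1 := by
      simp only [horizSq, Finset.sum_const, Finset.card_univ, Fintype.card_fin, nsmul_eq_mul]
      rw [Real.sq_sqrt (by positivity)]
      field_simp
      norm_num
    refine Continuous.integral_pos_of_hasCompactSupport_nonneg_nonzero
      (x := fun _ => √(1 / (2 * n))) ?_ ?_ (fun z => ?_) ?_
    · exact continuous_horizSq.mul ((contDiff_cutoff.continuous.comp continuous_horizSq).pow 2)
    · exact hasCompactSupport_comp_horizSq (F := fun s => s * cutoff s ^ 2) (C := 2)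
        fun s hs => by simp [cutoff_of_ge hs.le]
    · exact mul_nonneg (horizSq_nonneg z) (sq_nonneg _)
    · simp only [h1, cutoff_of_le le_rfl]
      norm_num
  set C0 := ∫ z : Fin (2 * n) → ℝ, horizSq z * cutoff (horizSq z) ^ 2
  set C1 := ∫ z : Fin (2 * n) → ℝ, horizSq z * deriv cutoff (horizSq z) ^ 2
  obtain ⟨r, hr, hrlt⟩ : ∃ r : ℝ, 0 < r ∧ 4 * r ^ 4 * C1 < η * C0 := by
    have h1 : Filter.Tendsto (fun r : ℝ => 4 * r ^ 4 * C1) (nhdsWithin 0 (Set.Ioi 0))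
        (nhds (4 * 0 ^ 4 * C1)) :=
      (Continuous.tendsto (by fun_prop) 0).mono_left nhdsWithin_le_nhds
    have h2 := h1.eventually_lt_const (u := η * C0) (by
      have := mul_pos hη hpos
      simpa using this)
    obtain ⟨r, h3, h4⟩ := (h2.and self_mem_nhdsWithin).exists
    exact ⟨r, h4, h3⟩
  refine ⟨fun s => cutoff (r ^ 2 * s), contDiff_cutoff.comp (contDiff_const.mul contDiff_id),
    ⟨2 / r ^ 2, fun s hs => cutoff_of_ge ?_⟩, ?_⟩
  · rw [div_lt_iff₀' (by positivity)] at hs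
    exact hs.le
  have hI0 : ∫ z : Fin (2 * n) → ℝ, horizSq z * cutoff (r ^ 2 * horizSq z) ^ 2 =
      (r ^ 2)⁻¹ * ((r ^ (2 * n))⁻¹ * C0) := by
    rw [← integral_horizSq_comp_smul (fun s => s * cutoff s ^ 2) hr, ← integral_const_mul]
    congr 1 with z
    field_simp
  have hI1 : ∫ z : Fin (2 * n) → ℝ,
      horizSq z * deriv (fun s => cutoff (r ^ 2 * s)) (horizSq z) ^ 2 =
      r ^ 2 * ((r ^ (2 * n))⁻¹ * C1) := by
    rw [← integral_horizSq_comp_smul (fun s => s * deriv cutoff s ^ 2) hr, ← integral_const_mul]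
    congr 1 with z
    rw [deriv_comp_mul_left, smul_eq_mul]
    ring
  rw [hI0, hI1]
  have h := mul_lt_mul_of_pos_left hrlt
    (show 0 < (r ^ 2)⁻¹ * (r ^ (2 * n))⁻¹ by positivity)
  have e : (r ^ 2)⁻¹ * r ^ 4 = r ^ 2 := by field_simp
  calc 4 * (r ^ 2 * ((r ^ (2 * n))⁻¹ * C1))
      = (r ^ 2)⁻¹ * (r ^ (2 * n))⁻¹ * (4 * r ^ 4 * C1) := by
        linear_combination -(4 * (r ^ (2 * n))⁻¹ * C1) * e
    _ < _ := h
    _ = _ := by ring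

/-- The splitting of a point of `ℍⁿ` into its vertical and horizontal parts. -/
def splitVert {n : ℕ} (ξ : Heis n) : ℝ × (Fin (2 * n) → ℝ) :=
  (ξ (tIdx n), fun j => ξ j.castSucc)

lemma horizSq_splitVert {n : ℕ} (ξ : Heis n) :
    horizSq (splitVert ξ).2 = ∑ i : Fin n, ((ξ (xIdx i)) ^ 2 + (ξ (yIdx i)) ^ 2) := rfl

lemma splitVert_eq {n : ℕ} : (splitVert (n := n)) =
    ((MeasurableEquiv.toLp 2 (Fin (2 * n + 1) → ℝ)).symm.trans
      (MeasurableEquiv.piFinSuccAbove (fun _ => ℝ) (Fin.last (2 * n)))) := by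
  ext ξ
  · rfl
  · simp [splitVert, MeasurableEquiv.piFinSuccAbove, Fin.init]

lemma measurableEmbedding_splitVert {n : ℕ} : MeasurableEmbedding (splitVert (n := n)) := by
  rw [splitVert_eq]
  exact MeasurableEquiv.measurableEmbedding _

lemma measurePreserving_splitVert {n : ℕ} : MeasurePreserving (splitVert (n := n)) := by
  rw [splitVert_eq]
  exact (volume_preserving_piFinSuccAbove (fun _ => ℝ) (Fin.last (2 * n))).comp
    (EuclideanSpace.volume_preserving_symm_measurableEquiv_toLp _)

lemma integral_mul_splitVert {n : ℕ} (G : ℝ → ℝ) (F : (Fin (2 * n) → ℝ) → ℝ) :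
    ∫ ξ : Heis n, G (splitVert ξ).1 * F (splitVert ξ).2 = (∫ t, G t) * ∫ z, F z := by
  rw [measurePreserving_splitVert.integral_comp measurableEmbedding_splitVert
    (fun p => G p.1 * F p.2)]
  exact integral_prod_mul G F

lemma integrable_mul_splitVert {n : ℕ} {G : ℝ → ℝ} {F : (Fin (2 * n) → ℝ) → ℝ}
    (hG : Integrable G) (hF : Integrable F) :
    Integrable fun ξ : Heis n => G (splitVert ξ).1 * F (splitVert ξ).2 :=
  (measurePreserving_splitVert.integrable_comp_emb measurableEmbedding_splitVert).2
    (hG.mul_prod hF)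

lemma contDiff_horizSq_splitVert {n : ℕ} :
    ContDiff ℝ (⊤ : ℕ∞) fun ξ : Heis n => horizSq (splitVert ξ).2 := by
  simp only [horizSq_splitVert]
  fun_prop

/-- The product of a vertical profile and a radial horizontal profile. -/
def cylProfile {n : ℕ} (g ρ : ℝ → ℝ) (ξ : Heis n) : ℝ :=
  g (ξ (tIdx n)) * ρ (horizSq (splitVert ξ).2)

lemma contDiff_cylProfile {n : ℕ} {g ρ : ℝ → ℝ} (hg : ContDiff ℝ (⊤ : ℕ∞) g)
    (hρ : ContDiff ℝ (⊤ : ℕ∞) ρ) : ContDiff ℝ (⊤ : ℕ∞) (cylProfile (n := n) g ρ) :=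
  (hg.comp (by fun_prop)).mul (hρ.comp contDiff_horizSq_splitVert)

lemma fderiv_cylProfile {n : ℕ} {g ρ : ℝ → ℝ} (hg : Differentiable ℝ g)
    (hρ : Differentiable ℝ ρ) (ξ v : Heis n) :
    fderiv ℝ (cylProfile g ρ) ξ v =
      deriv g (ξ (tIdx n)) * v (tIdx n) * ρ (horizSq (splitVert ξ).2) +
        g (ξ (tIdx n)) * (deriv ρ (horizSq (splitVert ξ).2) *
          ∑ i : Fin n, (2 * ξ (xIdx i) * v (xIdx i) + 2 * ξ (yIdx i) * v (yIdx i))) := by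
  have hc (j : Fin (2 * n + 1)) : HasFDerivAt (fun ξ : Heis n => ξ j)
      (EuclideanSpace.proj j : Heis n →L[ℝ] ℝ) ξ := PiLp.hasFDerivAt_apply 2 ξ j
  have hS : HasFDerivAt (fun ξ : Heis n => horizSq (splitVert ξ).2) _ ξ :=
    HasFDerivAt.fun_sum (u := Finset.univ) fun i _ =>
      ((hc (xIdx i)).pow 2).add ((hc (yIdx i)).pow 2)
  have h := ((hg _).hasDerivAt.comp_hasFDerivAt ξ (hc (tIdx n))).mul
    ((hρ _).hasDerivAt.comp_hasFDerivAt ξ hS)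
  have h' : HasFDerivAt (cylProfile g ρ) _ ξ := h
  rw [h'.fderiv]
  simp
  ring

lemma tIdx_ne_xIdx {n : ℕ} (i : Fin n) : tIdx n ≠ xIdx i := by
  have := i.2
  simp only [tIdx, xIdx, ne_eq, Fin.mk.injEq]
  omega

lemma tIdx_ne_yIdx {n : ℕ} (i : Fin n) : tIdx n ≠ yIdx i := by
  have := i.2
  simp only [tIdx, yIdx, ne_eq, Fin.mk.injEq]
  omega

lemma xIdx_ne_yIdx {n : ℕ} (i j : Fin n) : xIdx i ≠ yIdx j := by
  have := i.2
  simp only [xIdx, yIdx, ne_eq, Fin.mk.injEq]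
  omega

lemma xIdx_inj {n : ℕ} {i j : Fin n} : xIdx i = xIdx j ↔ i = j := by
  simp [xIdx, Fin.ext_iff]

lemma yIdx_inj {n : ℕ} {i j : Fin n} : yIdx i = yIdx j ↔ i = j := by
  simp [yIdx, Fin.ext_iff]

lemma gradH2_cylProfile {n : ℕ} {g ρ : ℝ → ℝ} (hg : Differentiable ℝ g)
    (hρ : Differentiable ℝ ρ) (ξ : Heis n) :
    gradH2 (cylProfile g ρ) ξ =
      g (ξ (tIdx n)) ^ 2 * (4 * (horizSq (splitVert ξ).2 *
        deriv ρ (horizSq (splitVert ξ).2) ^ 2)) +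
      4 * deriv g (ξ (tIdx n)) ^ 2 * (horizSq (splitVert ξ).2 *
        ρ (horizSq (splitVert ξ).2) ^ 2) := by
  set q := horizSq (splitVert ξ).2 with hq
  have hX (i : Fin n) : Xd i (cylProfile g ρ) ξ =
      2 * (g (ξ (tIdx n)) * deriv ρ q * ξ (xIdx i) + deriv g (ξ (tIdx n)) * ρ q * ξ (yIdx i)) := by
    simp only [Xd, fderiv_cylProfile hg hρ, ← hq]
    simp [tIdx_ne_xIdx, (tIdx_ne_xIdx _).symm, (tIdx_ne_yIdx _).symm,
      (xIdx_ne_yIdx _ _).symm, xIdx_inj]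
    ring
  have hY (i : Fin n) : Yd i (cylProfile g ρ) ξ =
      2 * (g (ξ (tIdx n)) * deriv ρ q * ξ (yIdx i) - deriv g (ξ (tIdx n)) * ρ q * ξ (xIdx i)) := by
    simp only [Yd, fderiv_cylProfile hg hρ, ← hq]
    simp [tIdx_ne_yIdx, (tIdx_ne_xIdx _).symm, (tIdx_ne_yIdx _).symm,
      xIdx_ne_yIdx, yIdx_inj]
    ring
  have : gradH2 (cylProfile g ρ) ξ = (4 * g (ξ (tIdx n)) ^ 2 * deriv ρ q ^ 2 +
      4 * deriv g (ξ (tIdx n)) ^ 2 * ρ q ^ 2) * q := by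
    rw [hq, horizSq_splitVert ξ, Finset.mul_sum, ← horizSq_splitVert ξ, ← hq]
    exact Finset.sum_congr rfl fun i _ => by rw [hX, hY]; ring
  rw [this]
  ring

lemma tsupport_cylProfile_subset {n : ℕ} {g ρ : ℝ → ℝ} {a b C : ℝ}
    (hg : ∀ t, t ∉ Set.Icc a b → g t = 0) (hρ : ∀ s, C < s → ρ s = 0) :
    tsupport (cylProfile (n := n) g ρ) ⊆
      {ξ : Heis n | ξ (tIdx n) ∈ Set.Icc a b ∧ horizSq (splitVert ξ).2 ≤ C} := by
  refine closure_minimal (fun ξ hξ => ⟨?_, ?_⟩) ?_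
  · by_contra h
    exact hξ (by simp [cylProfile, hg _ h])
  · by_contra! h
    exact hξ (by simp [cylProfile, hρ _ h])
  · exact (isClosed_Icc.preimage (by fun_prop)).inter
      (isClosed_le contDiff_horizSq_splitVert.continuous continuous_const)

lemma hasCompactSupport_cylProfile {n : ℕ} {g ρ : ℝ → ℝ} {a b C : ℝ}
    (hg : ∀ t, t ∉ Set.Icc a b → g t = 0) (hρ : ∀ s, C < s → ρ s = 0) :
    HasCompactSupport (cylProfile (n := n) g ρ) := by
  have hK : IsCompact ((EuclideanSpace.equiv (Fin (2 * n + 1)) ℝ).toHomeomorph ⁻¹'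
      Set.univ.pi fun _ => Set.Icc (-max (max |a| |b|) √C) (max (max |a| |b|) √C)) :=
    (Homeomorph.isCompact_preimage _).2 (isCompact_univ_pi fun _ => isCompact_Icc)
  refine hK.of_isClosed_subset (isClosed_tsupport _) fun ξ hξ => ?_
  obtain ⟨ht, hz⟩ := tsupport_cylProfile_subset hg hρ hξ
  refine fun j _ => abs_le.1 (?_ : |ξ j| ≤ _)
  induction j using Fin.lastCases with
  | last => exact (abs_le_max_abs_abs ht.1 ht.2).trans (le_max_left _ _)
  | cast j => exact (abs_le_of_horizSq_le hz j).trans (le_max_right _ _)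

/-- sharpness of the constant `1` in the Hardy inequality on the upper
half-space `ℍⁿ₊ = {t > 0}`: for every `ε > 0` there is a nonzero `u ∈ C_0^∞(ℍⁿ₊)` with
`∫ |∇_{ℍⁿ} u|² < (1 + ε) ∫ ((|x|² + |y|²)/t²)|u|²`. -/
theorem hardy_upper_halfspace_sharp (n : ℕ) (hn : 1 ≤ n) (ε : ℝ) (hε : 0 < ε) :
    ∃ u : Heis n → ℝ, ContDiff ℝ (⊤ : ℕ∞) u ∧ HasCompactSupport u ∧
      tsupport u ⊆ {ξ : Heis n | 0 < ξ (tIdx n)} ∧ u ≠ 0 ∧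
      ∫ ξ in {ξ : Heis n | 0 < ξ (tIdx n)}, gradH2 u ξ <
        (1 + ε) * ∫ ξ in {ξ : Heis n | 0 < ξ (tIdx n)},
          ((∑ i : Fin n, ((ξ (xIdx i)) ^ 2 + (ξ (yIdx i)) ^ 2)) / (ξ (tIdx n)) ^ 2)
            * (u ξ) ^ 2 := by
  obtain ⟨g, hg, ⟨a, b, ha, hgab⟩, hgI⟩ := exists_hardy_almost_minimizer (half_pos hε)
  set G0 := ∫ t, g t ^ 2 / t ^ 2
  set G1 := ∫ t, g t ^ 2
  set G2 := ∫ t, deriv g t ^ 2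
  have hG1 : 0 ≤ G1 := integral_nonneg fun _ => sq_nonneg _
  have hG2 : 0 ≤ G2 := integral_nonneg fun _ => sq_nonneg _
  have hG0 : 0 < G0 := by
    by_contra! h
    nlinarith
  obtain ⟨ρ, hρ, ⟨C, hρC⟩, hρI⟩ := exists_flat_radial_profile hn
    (η := ε / 2 * G0 / (G1 + 1)) (by positivity)
  set R0 := ∫ z : Fin (2 * n) → ℝ, horizSq z * ρ (horizSq z) ^ 2
  set R1 := ∫ z : Fin (2 * n) → ℝ, horizSq z * deriv ρ (horizSq z) ^ 2
  have hR1 : 0 ≤ R1 := integral_nonneg fun z => mul_nonneg (horizSq_nonneg z) (sq_nonneg _)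
  have hR0 : 0 < R0 := by
    have h1 : 0 < ε / 2 * G0 / (G1 + 1) := by positivity
    exact pos_of_mul_pos_right (by linarith) h1.le
  have hgd := hg.differentiable (by simp)
  have hρd := hρ.differentiable (by simp)
  have hgc : HasCompactSupport g := HasCompactSupport.intro isCompact_Icc hgab
  have hdg : Continuous (deriv g) := hg.continuous_deriv (by simp)
  have hdρ : Continuous (deriv ρ) := hρ.continuous_deriv (by simp)
  have htsupp : tsupport (cylProfile (n := n) g ρ) ⊆ {ξ : Heis n | 0 < ξ (tIdx n)} :=
    (tsupport_cylProfile_subset hgab hρC).trans fun ξ hξ => ha.trans_le hξ.1.1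
  have hzero (ξ : Heis n) (hξ : ξ ∉ {ξ : Heis n | 0 < ξ (tIdx n)}) : g (ξ (tIdx n)) = 0 :=
    hgab _ fun h => hξ (ha.trans_le h.1)
  have hdzero (ξ : Heis n) (hξ : ξ ∉ {ξ : Heis n | 0 < ξ (tIdx n)}) :
      deriv g (ξ (tIdx n)) = 0 := by
    have hlt : ξ (tIdx n) < a := (not_lt.1 hξ).trans_lt ha
    have : g =ᶠ[nhds (ξ (tIdx n))] fun _ => (0 : ℝ) := by
      filter_upwards [Iio_mem_nhds hlt] with x hx
      exact hgab x fun hx' => absurd hx'.1 (not_le.2 hx)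
    rw [this.deriv_eq, deriv_const]
  have hright : ∫ ξ in {ξ : Heis n | 0 < ξ (tIdx n)},
      ((∑ i : Fin n, ((ξ (xIdx i)) ^ 2 + (ξ (yIdx i)) ^ 2)) / (ξ (tIdx n)) ^ 2)
        * (cylProfile g ρ ξ) ^ 2 = G0 * R0 := by
    rw [setIntegral_eq_integral_of_forall_compl_eq_zero
      fun ξ hξ => by simp [cylProfile, hzero ξ hξ], ← integral_mul_splitVert]
    congr 1 with ξ
    rw [← horizSq_splitVert]
    simp only [cylProfile, splitVert]
    ring
  have hleft : ∫ ξ in {ξ : Heis n | 0 < ξ (tIdx n)}, gradH2 (cylProfile g ρ) ξ =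
      G1 * (4 * R1) + 4 * G2 * R0 := by
    simp only [gradH2_cylProfile hgd hρd]
    rw [setIntegral_eq_integral_of_forall_compl_eq_zero
      fun ξ hξ => by simp [hzero ξ hξ, hdzero ξ hξ]]
    have hI1 : Integrable fun t => g t ^ 2 :=
      (hg.continuous.pow 2).integrable_of_hasCompactSupport hgc.sq
    have hI2 : Integrable fun t => 4 * deriv g t ^ 2 :=
      ((hdg.pow 2).integrable_of_hasCompactSupport hgc.deriv.sq).const_mul 4
    have hJ1 : Integrable fun z : Fin (2 * n) → ℝ =>
        4 * (horizSq z * deriv ρ (horizSq z) ^ 2) :=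
      (integrable_horizSq_mul_sq hdρ fun s hs => deriv_eq_zero_of_forall_gt hρC hs).const_mul 4
    have hJ2 : Integrable fun z : Fin (2 * n) → ℝ => horizSq z * ρ (horizSq z) ^ 2 :=
      integrable_horizSq_mul_sq hρ.continuous hρC
    refine (integral_add (integrable_mul_splitVert hI1 hJ1)
      (integrable_mul_splitVert hI2 hJ2)).trans ?_
    rw [integral_mul_splitVert (fun t => g t ^ 2)
        (fun z => 4 * (horizSq z * deriv ρ (horizSq z) ^ 2)),
      integral_mul_splitVert (fun t => 4 * deriv g t ^ 2)
        (fun z => horizSq z * ρ (horizSq z) ^ 2), integral_const_mul, integral_const_mul]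
  refine ⟨cylProfile g ρ, contDiff_cylProfile hg hρ, hasCompactSupport_cylProfile hgab hρC,
    htsupp, fun h0 => ?_, ?_⟩
  · have : G0 * R0 = 0 := by
      rw [← hright, h0]
      simp
    exact (mul_pos hG0 hR0).ne' this
  · rw [hright, hleft]
    have h1 : (G1 + 1) * (4 * R1) < ε / 2 * G0 * R0 := by
      have := mul_lt_mul_of_pos_left hρI (show 0 < G1 + 1 by positivity)
      calc (G1 + 1) * (4 * R1) < _ := this
        _ = _ := by field_simp
    have h2 : 4 * G2 * R0 < (1 + ε / 2) * G0 * R0 := by gcongr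
    linarith
end
end

section
/- Let Ω ⊂ ℝ^N be an open set, p ≥ 2, u ∈ C_0^∞(Ω), g a C¹ real-valued function on a neighborhood of supp u, and V a C¹ vector field on a neighborhood of supp u. Then ∫_Ω (div(gV) − (p−1)|g|^{p/(p−1)}) |u|^p dξ ≤ ∫_Ω |⟨V, ∇u⟩|^p dξ, where div and ∇ denote the usual Euclidean divergence and gradient on ℝ^N. -/
open MeasureTheory RealInnerProductSpace

noncomputable section

/-- The pointwise Young inequality behind the divergence–gradient inequality. -/
lemma neg_mul_rpow_sub_two_le {p : ℝ} (hp : 1 < p) (a b d : ℝ) :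
    -(p * |a| ^ (p - 2) * a * d * b)
      ≤ |d| ^ p + (p - 1) * |b| ^ (p / (p - 1)) * |a| ^ p := by
  have hp1 : 0 < p - 1 := by linarith
  have hpq : p.HolderConjugate (p / (p - 1)) := Real.HolderConjugate.conjExponent hp
  have hy := Real.young_inequality_of_nonneg (abs_nonneg d)
    (mul_nonneg (abs_nonneg b) (Real.rpow_nonneg (abs_nonneg a) (p - 1))) hpq
  have hpow : (|b| * |a| ^ (p - 1)) ^ (p / (p - 1)) = |b| ^ (p / (p - 1)) * |a| ^ p := by
    rw [Real.mul_rpow (abs_nonneg b) (by positivity), ← Real.rpow_mul (abs_nonneg a),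
      mul_div_cancel₀ _ hp1.ne']
  have hmul : |a| ^ (p - 2) * |a| = |a| ^ (p - 1) := by
    rcases eq_or_ne a 0 with rfl | ha
    · simp [Real.zero_rpow hp1.ne']
    · rw [← Real.rpow_add_one (abs_ne_zero.2 ha)]
      ring_nf
  rw [hpow] at hy
  calc -(p * |a| ^ (p - 2) * a * d * b) ≤ |p * |a| ^ (p - 2) * a * d * b| := neg_le_abs _
    _ = p * (|d| * (|b| * |a| ^ (p - 1))) := by
      rw [abs_mul, abs_mul, abs_mul, abs_mul, abs_of_pos (by linarith : 0 < p),
        abs_of_nonneg (Real.rpow_nonneg (abs_nonneg a) (p - 2)), ← hmul]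
      ring
    _ ≤ p * (|d| ^ p / p + |b| ^ (p / (p - 1)) * |a| ^ p / (p / (p - 1))) := by gcongr
    _ = |d| ^ p + (p - 1) * |b| ^ (p / (p - 1)) * |a| ^ p := by field_simp

lemma integrable_of_continuousOn_of_eq_zero {X : Type*} [TopologicalSpace X] [T2Space X]
    [MeasurableSpace X] [OpensMeasurableSpace X] {μ : Measure X} [IsFiniteMeasureOnCompacts μ]
    {K : Set X} (hK : IsCompact K) {f : X → ℝ} (hf : ContinuousOn f K)
    (h0 : ∀ x ∉ K, f x = 0) : Integrable f μ :=
  (integrableOn_iff_integrable_of_support_subset fun x hx => by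
    by_contra h
    exact hx (h0 x h)).1 (hf.integrableOn_compact' hK hK.measurableSet)

lemma fderiv_abs_rpow_apply {E : Type*} [NormedAddCommGroup E] [NormedSpace ℝ E] {u : E → ℝ}
    {x : E} (hu : DifferentiableAt ℝ u x) {p : ℝ} (hp : 1 < p) (v : E) :
    fderiv ℝ (fun y => |u y| ^ p) x v = p * |u x| ^ (p - 2) * u x * fderiv ℝ u x v := by
  have h := (hasDerivAt_abs_rpow (u x) hp).comp_hasFDerivAt x hu.hasFDerivAt
  have h' : HasFDerivAt (fun y => |u y| ^ p) _ x := h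
  simp [h'.fderiv]

lemma EuclideanSpace.sum_apply_single_mul {ι : Type*} [Fintype ι] [DecidableEq ι]
    (L : EuclideanSpace ℝ ι →L[ℝ] ℝ) (v : EuclideanSpace ℝ ι) :
    ∑ j, L (EuclideanSpace.single j 1) * v j = L v := by
  conv_rhs => rw [← (EuclideanSpace.basisFun ι ℝ).sum_repr v]
  simp [mul_comm]

/-- the Euclidean divergence–gradient inequality used in the `L^p` proofs:
for `u ∈ C_0^∞(Ω)`, `g` a `C¹` function and `V` a `C¹` vector field on an open neighborhood
`U` of `supp u`, and `p ≥ 2`,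
`∫_Ω (div(gV) − (p−1)|g|^{p/(p−1)})|u|^p ≤ ∫_Ω |⟨V, ∇u⟩|^p`, where
`div(gV)(ξ) = Σ_j ∂_j(g V_j)(ξ)` and `⟨V, ∇u⟩(ξ) = (∇u)(ξ) ⬝ V ξ`. -/
theorem divergence_gradient_inequality (N : ℕ) (Ω U : Set (EuclideanSpace ℝ (Fin N)))
    (hΩ : IsOpen Ω) (hU : IsOpen U) (p : ℝ) (hp : 2 ≤ p)
    (u : EuclideanSpace ℝ (Fin N) → ℝ) (hu : ContDiff ℝ (⊤ : ℕ∞) u) (hc : HasCompactSupport u)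
    (hsupp : tsupport u ⊆ Ω) (hsuppU : tsupport u ⊆ U)
    (g : EuclideanSpace ℝ (Fin N) → ℝ) (hg : ContDiffOn ℝ 1 g U)
    (V : EuclideanSpace ℝ (Fin N) → EuclideanSpace ℝ (Fin N)) (hV : ContDiffOn ℝ 1 V U) :
    ∫ ξ in Ω,
        ((∑ j : Fin N, fderiv ℝ (fun η => g η * V η j) ξ (EuclideanSpace.single j 1))
            - (p - 1) * |g ξ| ^ (p / (p - 1))) * |u ξ| ^ p
      ≤ ∫ ξ in Ω, |fderiv ℝ u ξ (V ξ)| ^ p := by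
  have hp1 : 1 < p := by linarith
  have hp0 : p ≠ 0 := by linarith
  have hK : IsCompact (tsupport u) := hc
  have hu0 : ∀ ξ ∉ tsupport u, u ξ = 0 := fun ξ h => image_eq_zero_of_notMem_tsupport h
  have hdu0 : ∀ ξ ∉ tsupport u, fderiv ℝ u ξ = 0 := fun ξ h => fderiv_of_notMem_tsupport ℝ h
  have hu1 : ContDiff ℝ 1 u := hu.of_le (by exact_mod_cast le_top)
  have hw : ContDiff ℝ 1 fun ξ => |u ξ| ^ p := hu1.norm_rpow hp1
  have hw0 : ∀ ξ ∉ tsupport u, |u ξ| ^ p = 0 := fun ξ h => by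
    simp [hu0 ξ h, Real.zero_rpow hp0]
  have hwsupp : tsupport (fun ξ => |u ξ| ^ p) ⊆ tsupport u :=
    closure_minimal (fun ξ hξ => by
      by_contra h
      exact hξ (hw0 ξ h)) (isClosed_tsupport u)
  have hdw0 : ∀ ξ ∉ tsupport u, fderiv ℝ (fun η => |u η| ^ p) ξ = 0 := fun ξ h =>
    fderiv_of_notMem_tsupport ℝ fun h' => h (hwsupp h')
  have hgV : ∀ j, ContDiffOn ℝ 1 (fun η => g η * V η j) U := fun j =>
    hg.mul ((EuclideanSpace.proj (𝕜 := ℝ) j).contDiff.comp_contDiffOn hV)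
  have hdgV : ∀ j, ContinuousOn
      (fun ξ => fderiv ℝ (fun η => g η * V η j) ξ (EuclideanSpace.single j 1)) (tsupport u) :=
    fun j => (((hgV j).continuousOn_fderiv_of_isOpen hU le_rfl).clm_apply
      continuousOn_const).mono hsuppU
  have hint_div : ∀ j, Integrable fun ξ =>
      |u ξ| ^ p * fderiv ℝ (fun η => g η * V η j) ξ (EuclideanSpace.single j 1) := fun j =>
    integrable_of_continuousOn_of_eq_zero hK (hw.continuous.continuousOn.mul (hdgV j))
      fun ξ h => by simp [hw0 ξ h]
  have hint_grad : ∀ j, Integrable fun ξ =>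
      fderiv ℝ (fun η => |u η| ^ p) ξ (EuclideanSpace.single j 1) * (g ξ * V ξ j) := fun j =>
    integrable_of_continuousOn_of_eq_zero hK
      (((hw.continuous_fderiv one_ne_zero).clm_apply continuous_const).continuousOn.mul
        ((hgV j).continuousOn.mono hsuppU)) fun ξ h => by simp [hdw0 ξ h]
  have hint_prod : ∀ j, Integrable fun ξ => |u ξ| ^ p * (g ξ * V ξ j) := fun j =>
    integrable_of_continuousOn_of_eq_zero hK
      (hw.continuous.continuousOn.mul ((hgV j).continuousOn.mono hsuppU))
      fun ξ h => by simp [hw0 ξ h]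
  have hint_pot : Integrable fun ξ => (p - 1) * |g ξ| ^ (p / (p - 1)) * |u ξ| ^ p :=
    integrable_of_continuousOn_of_eq_zero hK
      ((continuousOn_const.mul ((hg.continuousOn.mono hsuppU).abs.rpow_const fun ξ _ =>
        Or.inr (div_nonneg (by linarith) (by linarith)))).mul hw.continuous.continuousOn)
      fun ξ h => by simp [hw0 ξ h]
  have hint_rhs : Integrable fun ξ => |fderiv ℝ u ξ (V ξ)| ^ p :=
    integrable_of_continuousOn_of_eq_zero hK
      (((hu1.continuous_fderiv one_ne_zero).continuousOn.clm_apply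
        (hV.continuousOn.mono hsuppU)).abs.rpow_const fun ξ _ => Or.inr (by linarith))
      fun ξ h => by simp [hdu0 ξ h, Real.zero_rpow hp0]
  have hint_neg : Integrable fun ξ =>
      -∑ j, fderiv ℝ (fun η => |u η| ^ p) ξ (EuclideanSpace.single j 1) * (g ξ * V ξ j) :=
    (integrable_finsetSum _ fun j _ => hint_grad j).neg
  have hparts : ∀ j,
      ∫ ξ, |u ξ| ^ p * fderiv ℝ (fun η => g η * V η j) ξ (EuclideanSpace.single j 1)
        = -∫ ξ, fderiv ℝ (fun η => |u η| ^ p) ξ (EuclideanSpace.single j 1) * (g ξ * V ξ j) :=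
    fun j => integral_mul_fderiv_eq_neg_fderiv_mul_of_integrable (hint_grad j) (hint_div j)
      (hint_prod j) (fun ξ _ => hw.differentiable one_ne_zero ξ) fun ξ hξ =>
        ((hgV j).contDiffAt (hU.mem_nhds (hsuppU (hwsupp hξ)))).differentiableAt one_ne_zero
  have hsum : ∀ ξ,
      ∑ j, fderiv ℝ (fun η => |u η| ^ p) ξ (EuclideanSpace.single j 1) * (g ξ * V ξ j)
        = p * |u ξ| ^ (p - 2) * u ξ * fderiv ℝ u ξ (V ξ) * g ξ := fun ξ => by
    rw [← fderiv_abs_rpow_apply (hu1.differentiable one_ne_zero ξ) hp1,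
      ← EuclideanSpace.sum_apply_single_mul, Finset.sum_mul]
    exact Finset.sum_congr rfl fun j _ => by ring
  rw [setIntegral_eq_integral_of_forall_compl_eq_zero fun ξ h => by
      rw [hw0 ξ fun h' => h (hsupp h'), mul_zero],
    setIntegral_eq_integral_of_forall_compl_eq_zero fun ξ h => by
      simp [hdu0 ξ fun h' => h (hsupp h'), Real.zero_rpow hp0]]
  calc ∫ ξ, ((∑ j, fderiv ℝ (fun η => g η * V η j) ξ (EuclideanSpace.single j 1))
            - (p - 1) * |g ξ| ^ (p / (p - 1))) * |u ξ| ^ p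
      = ∫ ξ, ((∑ j, |u ξ| ^ p *
            fderiv ℝ (fun η => g η * V η j) ξ (EuclideanSpace.single j 1))
          - (p - 1) * |g ξ| ^ (p / (p - 1)) * |u ξ| ^ p) := by
        refine integral_congr_ae (.of_forall fun ξ => ?_)
        simp only [sub_mul, Finset.sum_mul, mul_comm (|u ξ| ^ p)]
    _ = ∫ ξ, (-(p * |u ξ| ^ (p - 2) * u ξ * fderiv ℝ u ξ (V ξ) * g ξ)
          - (p - 1) * |g ξ| ^ (p / (p - 1)) * |u ξ| ^ p) := by
        simp_rw [← hsum]
        rw [integral_sub (integrable_finsetSum _ fun j _ => hint_div j) hint_pot,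
          integral_sub hint_neg hint_pot,
          integral_neg, integral_finsetSum _ fun j _ => hint_div j,
          integral_finsetSum _ fun j _ => hint_grad j, Finset.sum_congr rfl fun j _ => hparts j,
          Finset.sum_neg_distrib]
    _ ≤ ∫ ξ, |fderiv ℝ u ξ (V ξ)| ^ p := by
        refine integral_mono ?_ hint_rhs fun ξ => ?_
        · simp_rw [← hsum]
          exact hint_neg.sub hint_pot
        · exact sub_le_iff_le_add.2 (neg_mul_rpow_sub_two_le hp1 _ _ _)
end
end

section
/- Let n ≥ 1 and let Ω ⊂ ℝ^{2n+1} be a bounded open convex polytope, i.e. the interior of the intersection of finitely many closed half-spaces, with facets F_k and corresponding inward unit normals ν_k. Partition Ω into the essentially disjoint sets Ω_k = {ξ ∈ Ω : dist(ξ, ∂Ω) = dist(ξ, F_k)}, and for ξ ∈ Ω_k set ν(ξ) = ν_k. Then for every u ∈ C_0^∞(Ω) one has ∫_Ω |∇_{ℍⁿ} u|² dξ ≥ (1/4) ∫_Ω Σ_{i=1}^n (⟨X_i(ξ), ν(ξ)⟩² + ⟨Y_i(ξ), ν(ξ)⟩²) / dist(ξ, ∂Ω)² · |u|² dξ, where dist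 denotes Euclidean distance. -/
open MeasureTheory RealInnerProductSpace

noncomputable section

section HardyAlongField

open Filter Topology Set

variable {K : Type*} [Fintype K]

/-- The logarithmic derivative, in a direction with slopes `b k`, of the smooth approximation
`(∑ k, δ k ^ (-(p + 1))) ^ (-1 / (p + 1))` of `min_k δ k`. -/
def softMinLogDeriv (p : ℕ) (b δ : K → ℝ) : ℝ :=
  (∑ k, b k * (δ k)⁻¹ ^ (p + 2)) / ∑ k, (δ k)⁻¹ ^ (p + 1)

lemma sum_inv_pow_pos [Nonempty K] (p : ℕ) {δ : K → ℝ} (hδ : ∀ k, 0 < δ k) :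
    0 < ∑ k, (δ k)⁻¹ ^ p :=
  Finset.sum_pos (fun k _ => pow_pos (inv_pos.2 (hδ k)) _) Finset.univ_nonempty

lemma hasDerivAt_inv_affine_pow {δ : ℝ} (hδ : 0 < δ) (b : ℝ) (m : ℕ) :
    HasDerivAt (fun s : ℝ => (δ + s * b)⁻¹ ^ (m + 1)) (-((m + 1) * b * δ⁻¹ ^ (m + 2))) 0 := by
  have h1 : HasDerivAt (fun s : ℝ => δ + s * b) b 0 := by
    simpa using ((hasDerivAt_id (0 : ℝ)).mul_const b).const_add δ
  have h2 := (h1.fun_inv (by simpa using hδ.ne')).fun_pow (m + 1)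
  refine h2.congr_deriv ?_
  rw [Nat.add_sub_cancel, zero_mul, add_zero]
  push_cast
  simp only [div_eq_mul_inv, ← inv_pow]
  ring

/-- The logarithmic derivative of the soft minimum satisfies a Riccati differential inequality
along lines. -/
lemma exists_hasDerivAt_softMinLogDeriv_le [Nonempty K] (p : ℕ) (b : K → ℝ) {δ : K → ℝ}
    (hδ : ∀ k, 0 < δ k) :
    ∃ D : ℝ, HasDerivAt (fun s : ℝ => softMinLogDeriv p b (fun k => δ k + s * b k)) D 0 ∧
      D ≤ -(softMinLogDeriv p b δ) ^ 2 := by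
  have hS := sum_inv_pow_pos (p + 1) hδ
  have hN : HasDerivAt (fun s : ℝ => ∑ k, b k * (δ k + s * b k)⁻¹ ^ (p + 2))
      (∑ k, b k * -(((p + 1 : ℕ) + 1) * b k * (δ k)⁻¹ ^ (p + 3))) 0 :=
    HasDerivAt.fun_sum fun k _ =>
      (hasDerivAt_inv_affine_pow (hδ k) (b k) (p + 1)).const_mul (b k)
  have hD : HasDerivAt (fun s : ℝ => ∑ k, (δ k + s * b k)⁻¹ ^ (p + 1))
      (∑ k, -((p + 1) * b k * (δ k)⁻¹ ^ (p + 2))) 0 :=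
    HasDerivAt.fun_sum fun k _ => hasDerivAt_inv_affine_pow (hδ k) (b k) p
  have hcs : (∑ k, b k * (δ k)⁻¹ ^ (p + 2)) ^ 2 ≤
      (∑ k, b k ^ 2 * (δ k)⁻¹ ^ (p + 3)) * ∑ k, (δ k)⁻¹ ^ (p + 1) := by
    refine Finset.sum_sq_le_sum_mul_sum_of_sq_le_mul _ (fun k _ => ?_) (fun k _ => ?_)
      (fun k _ => le_of_eq (by ring))
    · have := hδ k
      positivity
    · have := hδ k
      positivity
  refine ⟨_, hN.fun_div hD (by simpa using hS.ne'), ?_⟩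
  have e1 : ∑ k, b k * -(((p + 1 : ℕ) + 1) * b k * (δ k)⁻¹ ^ (p + 3)) =
      -((p + 2) * ∑ k, b k ^ 2 * (δ k)⁻¹ ^ (p + 3)) := by
    rw [Finset.mul_sum, ← Finset.sum_neg_distrib]
    refine Finset.sum_congr rfl fun k _ => ?_
    push_cast
    ring
  have e2 : ∑ k, -((p + 1) * b k * (δ k)⁻¹ ^ (p + 2)) =
      -((p + 1) * ∑ k, b k * (δ k)⁻¹ ^ (p + 2)) := by
    rw [Finset.mul_sum, ← Finset.sum_neg_distrib]
    exact Finset.sum_congr rfl fun k _ => by ring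
  rw [e1, e2]
  simp only [softMinLogDeriv, zero_mul, add_zero]
  generalize (∑ k, b k * (δ k)⁻¹ ^ (p + 2)) = N at *
  generalize (∑ k, b k ^ 2 * (δ k)⁻¹ ^ (p + 3)) = Q at *
  generalize (∑ k, (δ k)⁻¹ ^ (p + 1)) = S at *
  rw [div_pow, ← neg_div, div_le_div_iff_of_pos_right (by positivity)]
  have hp : (0 : ℝ) ≤ p := p.cast_nonneg
  nlinarith [mul_le_mul_of_nonneg_left hcs (by positivity : (0 : ℝ) ≤ p + 2)]

lemma abs_softMinLogDeriv_le [Nonempty K] (p : ℕ) (b : K → ℝ) {δ : K → ℝ} (hδ : ∀ k, 0 < δ k) :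
    |softMinLogDeriv p b δ| ≤ ∑ k, |b k| * (δ k)⁻¹ := by
  have hS := sum_inv_pow_pos (p + 1) hδ
  rw [softMinLogDeriv, abs_div, abs_of_pos hS, div_le_iff₀ hS, Finset.mul_sum]
  refine (Finset.abs_sum_le_sum_abs _ _).trans (Finset.sum_le_sum fun k _ => ?_)
  have hk := inv_pos.2 (hδ k)
  rw [abs_mul, abs_of_pos (pow_pos hk _), pow_succ', ← mul_assoc]
  refine mul_le_mul_of_nonneg_right ?_ (by positivity)
  exact Finset.single_le_sum (f := fun j => |b j| * (δ j)⁻¹)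
    (fun j _ => mul_nonneg (abs_nonneg _) (inv_pos.2 (hδ j)).le) (Finset.mem_univ k)

lemma tendsto_softMinLogDeriv (b : K → ℝ) {δ : K → ℝ} (hδ : ∀ k, 0 < δ k) (m : K)
    (hm : ∀ k, δ m ≤ δ k) (htie : ∀ k, δ k = δ m → b k = b m) :
    Tendsto (fun p => softMinLogDeriv p b δ) atTop (𝓝 (b m / δ m)) := by
  classical
  set τ : K → ℝ := fun k => if δ k = δ m then 1 else 0 with hτ
  have ht : ∀ k, Tendsto (fun p : ℕ => (δ m / δ k) ^ (p + 1)) atTop (𝓝 (τ k)) := by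
    intro k
    refine (tendsto_add_atTop_iff_nat (f := fun p : ℕ => (δ m / δ k) ^ p) 1).2 ?_
    by_cases h : δ k = δ m
    · simp [hτ, h, (hδ m).ne']
    · simp only [hτ, h, if_false]
      refine tendsto_pow_atTop_nhds_zero_of_lt_one (div_pos (hδ m) (hδ k)).le ?_
      exact (div_lt_one (hδ k)).2 (lt_of_le_of_ne (hm k) (Ne.symm h))
  have hτpos : 0 < ∑ k, τ k :=
    Finset.sum_pos' (fun k _ => by simp only [hτ]; split_ifs <;> norm_num)
      ⟨m, Finset.mem_univ m, by simp [hτ]⟩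
  have hnum : Tendsto (fun p : ℕ => ∑ k, b k / δ k * (δ m / δ k) ^ (p + 1)) atTop
      (𝓝 (∑ k, b k / δ k * τ k)) :=
    tendsto_finsetSum _ fun k _ => (ht k).const_mul _
  have hden : Tendsto (fun p : ℕ => ∑ k, (δ m / δ k) ^ (p + 1)) atTop (𝓝 (∑ k, τ k)) :=
    tendsto_finsetSum _ fun k _ => ht k
  have hlim : (∑ k, b k / δ k * τ k) / ∑ k, τ k = b m / δ m := by
    rw [div_eq_iff hτpos.ne', Finset.mul_sum]
    refine Finset.sum_congr rfl fun k _ => ?_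
    by_cases h : δ k = δ m
    · rw [h, htie k h]
    · simp [hτ, h]
  rw [← hlim]
  refine (hnum.div hden hτpos.ne').congr fun p => ?_
  have hpos : δ m ^ (p + 1) ≠ 0 := (pow_pos (hδ m) _).ne'
  rw [softMinLogDeriv, ← mul_div_mul_left _ (∑ k, (δ k)⁻¹ ^ (p + 1)) hpos, Finset.mul_sum,
    Finset.mul_sum]
  simp only [Pi.div_apply]
  congr 1
  · refine Finset.sum_congr rfl fun k _ => ?_
    rw [div_eq_mul_inv, div_eq_mul_inv, mul_pow]
    ring
  · exact Finset.sum_congr rfl fun k _ => by rw [div_eq_mul_inv, mul_pow]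

lemma continuous_mul_of_tsupport_subset {X : Type*} [TopologicalSpace X] {u f : X → ℝ} {Ω : Set X}
    (hu : Continuous u) (hsupp : tsupport u ⊆ Ω) (hf : ∀ ξ ∈ Ω, ContinuousAt f ξ) :
    Continuous (fun ξ => u ξ * f ξ) := by
  refine continuous_iff_continuousAt.2 fun ξ => ?_
  by_cases h : ξ ∈ tsupport u
  · exact hu.continuousAt.mul (hf ξ (hsupp h))
  · refine (continuousAt_const (y := (0 : ℝ))).congr ?_
    filter_upwards [notMem_tsupport_iff_eventuallyEq.1 h] with η hη
    simp [hη]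

variable {E : Type*} [NormedAddCommGroup E] [InnerProductSpace ℝ E]

lemma contDiff_mul_of_tsupport_subset {u f : E → ℝ} {Ω : Set E} {m : WithTop ℕ∞}
    (hu : ContDiff ℝ m u) (hsupp : tsupport u ⊆ Ω) (hf : ∀ ξ ∈ Ω, ContDiffAt ℝ m f ξ) :
    ContDiff ℝ m (fun ξ => u ξ * f ξ) := by
  refine contDiff_iff_contDiffAt.2 fun ξ => ?_
  by_cases h : ξ ∈ tsupport u
  · exact hu.contDiffAt.mul (hf ξ (hsupp h))
  · refine (contDiffAt_const (c := (0 : ℝ))).congr_of_eventuallyEq ?_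
    filter_upwards [notMem_tsupport_iff_eventuallyEq.1 h] with η hη
    simp [hη]

lemma infDist_frontier_polytope {ν : K → E} (hν : ∀ k, ‖ν k‖ = 1) {d : K → ℝ} {ξ : E}
    (hξ : ∀ k, d k < ⟪ξ, ν k⟫) {m : K} (hm : ∀ k, ⟪ξ, ν m⟫ - d m ≤ ⟪ξ, ν k⟫ - d k) :
    Metric.infDist ξ (frontier {η : E | ∀ k, d k < ⟪η, ν k⟫}) = ⟪ξ, ν m⟫ - d m := by
  set Ω := {η : E | ∀ k, d k < ⟪η, ν k⟫} with hΩ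
  set r := ⟪ξ, ν m⟫ - d m with hr
  have hr0 : 0 < r := sub_pos.2 (hξ m)
  have hfar : ∀ η, η ∉ Ω → r ≤ dist ξ η := by
    intro η hη
    simp only [hΩ, mem_ofPred_eq, not_forall, not_lt] at hη
    obtain ⟨k, hk⟩ := hη
    have h1 : ⟪ξ - η, ν k⟫ ≤ ‖ξ - η‖ := by
      simpa [hν k] using real_inner_le_norm (ξ - η) (ν k)
    rw [inner_sub_left] at h1
    rw [dist_eq_norm]
    linarith [hm k]
  have hopen : IsOpen Ω := by
    rw [hΩ, ofPred_forall]
    exact isOpen_iInter_of_finite fun k =>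
      isOpen_lt continuous_const (continuous_id.inner continuous_const)
  have hball : Metric.ball ξ r ⊆ Ω := by
    intro η hη
    by_contra h
    rw [Metric.mem_ball, dist_comm] at hη
    exact absurd (hfar η h) (not_le.2 hη)
  have hmem : ξ - r • ν m ∈ frontier Ω := by
    rw [hopen.frontier_eq]
    refine ⟨closure_mono hball ?_, ?_⟩
    · rw [closure_ball _ hr0.ne', mem_closedBall_iff_norm]
      simp [norm_smul, hν m, abs_of_pos hr0]
    · intro h
      have := h m
      rw [inner_sub_left, real_inner_smul_left, real_inner_self_eq_norm_sq, hν m] at this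
      linarith
  refine le_antisymm ?_ ?_
  · refine (Metric.infDist_le_dist_of_mem hmem).trans ?_
    simp [norm_smul, hν m, abs_of_pos hr0]
  · refine (Metric.le_infDist ⟨_, hmem⟩).2 fun η hη => hfar η ?_
    rw [hopen.frontier_eq] at hη
    exact hη.2

lemma continuous_fderiv_field {G : E → ℝ} (hG : ContDiff ℝ 1 G) (e f : E) (L : E →L[ℝ] ℝ) :
    Continuous fun ξ => fderiv ℝ G ξ (e + L ξ • f) :=
  (hG.continuous_fderiv one_ne_zero).clm_apply
    (continuous_const.add (L.continuous.smul continuous_const))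

lemma hasCompactSupport_fderiv_field {G : E → ℝ} (hG : HasCompactSupport G) (e f : E)
    (L : E →L[ℝ] ℝ) : HasCompactSupport fun ξ => fderiv ℝ G ξ (e + L ξ • f) :=
  (hG.fderiv ℝ).mono fun ξ hξ h => hξ (by simp [h])

variable [MeasurableSpace E] [BorelSpace E] (μ : Measure E) [μ.IsAddHaarMeasure]

lemma integrable_fderiv_field_sq {u : E → ℝ} (hu : ContDiff ℝ 1 u) (hc : HasCompactSupport u)
    (e f : E) (L : E →L[ℝ] ℝ) :
    Integrable (fun ξ => (fderiv ℝ u ξ (e + L ξ • f)) ^ 2) μ := by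
  refine ((continuous_fderiv_field hu e f L).pow 2).integrable_of_hasCompactSupport
    ((hasCompactSupport_fderiv_field hc e f L).mono fun ξ hξ h => hξ ?_)
  simp only [Pi.pow_apply] at h ⊢
  rw [h, zero_pow two_ne_zero]

variable [FiniteDimensional ℝ E]

lemma measure_inner_eq_const {w : E} (hw : w ≠ 0) (c : ℝ) : μ {ξ : E | ⟪ξ, w⟫ = c} = 0 := by
  rcases eq_empty_or_nonempty {ξ : E | ⟪ξ, w⟫ = c} with h | ⟨ξ₀, h₀⟩
  · rw [h, measure_empty]
  have hset : {ξ : E | ⟪ξ, w⟫ = c} =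
      (fun ξ => ξ + -ξ₀) ⁻¹' ((innerSL ℝ w).toLinearMap.ker : Set E) := by
    ext ξ
    have h₀' : ⟪ξ₀, w⟫ = c := h₀
    change ⟪ξ, w⟫ = c ↔ ⟪w, ξ + -ξ₀⟫ = 0
    rw [inner_add_right, inner_neg_right, real_inner_comm ξ w, real_inner_comm ξ₀ w, h₀',
      ← sub_eq_add_neg, sub_eq_zero]
  rw [hset, measure_preimage_add_right]
  refine Measure.addHaar_submodule μ _ fun htop => hw ?_
  have : w ∈ (innerSL ℝ w).toLinearMap.ker := htop ▸ Submodule.mem_top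
  simpa using this

/-- The field `e + L • f` is divergence-free when `L f = 0`. -/
lemma integral_fderiv_field_eq_zero {G : E → ℝ} (hG : ContDiff ℝ 1 G) (hGc : HasCompactSupport G)
    (e f : E) (L : E →L[ℝ] ℝ) (hLf : L f = 0) :
    ∫ ξ, fderiv ℝ G ξ (e + L ξ • f) ∂μ = 0 := by
  have hd : ∀ v, Continuous fun ξ => fderiv ℝ G ξ v := fun v =>
    (hG.continuous_fderiv one_ne_zero).clm_apply continuous_const
  have hdc : ∀ v, HasCompactSupport fun ξ => fderiv ℝ G ξ v := fun v => hGc.fderiv_apply ℝ v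
  have hdi : ∀ v, Integrable (fun ξ => fderiv ℝ G ξ v) μ := fun v =>
    (hd v).integrable_of_hasCompactSupport (hdc v)
  have hLi : ∀ v, Integrable (fun ξ => L ξ * fderiv ℝ G ξ v) μ := fun v =>
    (L.continuous.mul (hd v)).integrable_of_hasCompactSupport (hdc v).mul_left
  have hGd : Differentiable ℝ G := hG.differentiable one_ne_zero
  have h1 : ∫ ξ, fderiv ℝ G ξ e ∂μ = 0 := by
    have := integral_mul_fderiv_eq_neg_fderiv_mul_of_integrable (μ := μ) (f := fun _ : E => (1 : ℝ))
      (g := G) (v := e) (by simp) (by simpa using hdi e)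
      (by simpa using hG.continuous.integrable_of_hasCompactSupport hGc)
      (fun x _ => differentiableAt_const _) (fun x _ => hGd x)
    simpa using this
  have h2 : ∫ ξ, L ξ * fderiv ℝ G ξ f ∂μ = 0 := by
    have := integral_mul_fderiv_eq_neg_fderiv_mul_of_integrable (μ := μ) (f := L)
      (g := G) (v := f) (by simp [hLf]) (hLi f)
      ((L.continuous.mul hG.continuous).integrable_of_hasCompactSupport hGc.mul_left)
      (fun x _ => L.differentiableAt) (fun x _ => hGd x)
    simpa [hLf] using this
  simp only [map_add, map_smul, smul_eq_mul]
  rw [integral_add (hdi e) (hLi f), h1, h2, add_zero]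

variable [Nonempty K]

/-- Hardy inequality along the field `e + L • f`, with the weight of the soft minimum. -/
lemma hardy_softMin (p : ℕ) (ν : K → E) (d : K → ℝ) (e f : E) (L : E →L[ℝ] ℝ)
    (hLe : L e = 0) (hLf : L f = 0) {u : E → ℝ} (hu : ContDiff ℝ 1 u)
    (hc : HasCompactSupport u) (hsupp : tsupport u ⊆ {ξ : E | ∀ k, d k < ⟪ξ, ν k⟫}) :
    Integrable (fun ξ => u ξ ^ 2 *
      softMinLogDeriv p (fun k => ⟪e + L ξ • f, ν k⟫) (fun k => ⟪ξ, ν k⟫ - d k) ^ 2) μ ∧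
    1 / 4 * ∫ ξ, u ξ ^ 2 *
      softMinLogDeriv p (fun k => ⟪e + L ξ • f, ν k⟫) (fun k => ⟪ξ, ν k⟫ - d k) ^ 2 ∂μ ≤
      ∫ ξ, (fderiv ℝ u ξ (e + L ξ • f)) ^ 2 ∂μ := by
  set F : E → ℝ := fun ξ =>
    softMinLogDeriv p (fun k => ⟪e + L ξ • f, ν k⟫) (fun k => ⟪ξ, ν k⟫ - d k) with hF
  set Ω := {ξ : E | ∀ k, d k < ⟪ξ, ν k⟫} with hΩ
  have hpos : ∀ ξ ∈ Ω, ∀ k, 0 < ⟪ξ, ν k⟫ - d k := fun ξ hξ k => sub_pos.2 (hξ k)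
  have hFs : ∀ ξ ∈ Ω, ContDiffAt ℝ 1 F ξ := by
    intro ξ hξ
    have hinv : ∀ k, ContDiffAt ℝ 1 (fun η : E => (⟪η, ν k⟫ - d k)⁻¹) ξ := fun k =>
      ((contDiffAt_id.inner ℝ contDiffAt_const).sub contDiffAt_const).inv (hpos ξ hξ k).ne'
    refine ContDiffAt.div (ContDiffAt.sum fun k _ => ?_)
      (ContDiffAt.sum fun k _ => (hinv k).pow _) (sum_inv_pow_pos _ (hpos ξ hξ)).ne'
    exact ((contDiffAt_const.add (L.contDiff.contDiffAt.smul contDiffAt_const)).inner ℝ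
      contDiffAt_const).mul ((hinv k).pow _)
  have hu2 : ContDiff ℝ 1 (fun ξ => u ξ ^ 2) := hu.pow 2
  have hu2eq : (fun ξ => u ξ ^ 2) = u * u := by
    ext ξ
    simp [sq]
  have hc2 : HasCompactSupport (fun ξ => u ξ ^ 2) := hu2eq ▸ hc.mul_left
  have hsupp2 : tsupport (fun ξ => u ξ ^ 2) ⊆ Ω :=
    hu2eq ▸ (tsupport_mul_subset_left).trans hsupp
  have hG : ContDiff ℝ 1 (fun ξ => u ξ ^ 2 * F ξ) :=
    contDiff_mul_of_tsupport_subset hu2 hsupp2 hFs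
  have hGc : HasCompactSupport (fun ξ => u ξ ^ 2 * F ξ) := hc2.mul_right
  have hIw : Integrable (fun ξ => u ξ ^ 2 * F ξ ^ 2) μ :=
    (contDiff_mul_of_tsupport_subset hu2 hsupp2
      fun ξ hξ => (hFs ξ hξ).pow 2).continuous.integrable_of_hasCompactSupport hc2.mul_right
  have hIG : Integrable (fun ξ => fderiv ℝ (fun ξ => u ξ ^ 2 * F ξ) ξ (e + L ξ • f)) μ :=
    (continuous_fderiv_field hG e f L).integrable_of_hasCompactSupport
      (hasCompactSupport_fderiv_field hGc e f L)
  have hIu := integrable_fderiv_field_sq μ hu hc e f L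
  refine ⟨hIw, ?_⟩
  have hpt : ∀ ξ, 1 / 4 * (u ξ ^ 2 * F ξ ^ 2) +
      1 / 2 * fderiv ℝ (fun ξ => u ξ ^ 2 * F ξ) ξ (e + L ξ • f) ≤
      (fderiv ℝ u ξ (e + L ξ • f)) ^ 2 := by
    intro ξ
    by_cases h : ξ ∈ tsupport u
    · have hξ := hsupp h
      have hFd : DifferentiableAt ℝ F ξ := (hFs ξ hξ).differentiableAt one_ne_zero
      have hud : DifferentiableAt ℝ u ξ := hu.differentiable one_ne_zero ξ
      have hprod : fderiv ℝ (fun ξ => u ξ ^ 2 * F ξ) ξ (e + L ξ • f) =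
          u ξ ^ 2 * fderiv ℝ F ξ (e + L ξ • f) +
            F ξ * (2 * u ξ * fderiv ℝ u ξ (e + L ξ • f)) := by
        rw [((hud.hasFDerivAt.pow 2).fun_mul hFd.hasFDerivAt).fderiv]
        simp
      obtain ⟨D, hD, hDle⟩ := exists_hasDerivAt_softMinLogDeriv_le p
        (fun k => ⟪e + L ξ • f, ν k⟫) (hpos ξ hξ)
      have hline : (fun s : ℝ => F (ξ + s • (e + L ξ • f))) = fun s : ℝ =>
          softMinLogDeriv p (fun k => ⟪e + L ξ • f, ν k⟫)
            (fun k => ⟪ξ, ν k⟫ - d k + s * ⟪e + L ξ • f, ν k⟫) := by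
        ext s
        have hL : L (ξ + s • (e + L ξ • f)) = L ξ := by simp [hLe, hLf]
        simp only [hF, hL]
        congr 1
        ext k
        rw [inner_add_left ξ, real_inner_smul_left]
        ring
      have hDeq : fderiv ℝ F ξ (e + L ξ • f) = D := by
        have h1 : HasDerivAt (fun s : ℝ => F (ξ + s • (e + L ξ • f))) _ 0 :=
          hFd.hasFDerivAt.hasLineDerivAt (e + L ξ • f)
        rw [hline] at h1
        exact h1.unique hD
      rw [hprod, hDeq]
      have h3 : u ξ ^ 2 * D ≤ u ξ ^ 2 * -(F ξ) ^ 2 :=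
        mul_le_mul_of_nonneg_left hDle (sq_nonneg _)
      nlinarith [sq_nonneg (fderiv ℝ u ξ (e + L ξ • f) - 1 / 2 * (u ξ * F ξ))]
    · have h0 : u =ᶠ[𝓝 ξ] 0 := notMem_tsupport_iff_eventuallyEq.1 h
      have hG0 : (fun ξ => u ξ ^ 2 * F ξ) =ᶠ[𝓝 ξ] fun _ => (0 : ℝ) := by
        filter_upwards [h0] with η hη
        simp [hη]
      rw [hG0.fderiv_eq, h0.eq_of_nhds]
      simp [sq_nonneg]
  have hint := integral_mono ((hIw.const_mul (1 / 4)).add (hIG.const_mul (1 / 2))) hIu hpt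
  simp only [Pi.add_apply] at hint
  rwa [integral_add (hIw.const_mul (1 / 4)) (hIG.const_mul (1 / 2)), integral_const_mul,
    integral_const_mul, integral_fderiv_field_eq_zero μ hG hGc e f L hLf, mul_zero,
    add_zero] at hint

/-- Hardy inequality in a polytope along the field `e + L • f`, with the distance to the
nearest facet in the weight. -/
lemma hardy_nearest_facet (ν : K → E) (d : K → ℝ) (e f : E)
    (L : E →L[ℝ] ℝ) (hLe : L e = 0) (hLf : L f = 0) (σ : E → K)
    (hσ : ∀ ξ ∈ {ξ : E | ∀ k, d k < ⟪ξ, ν k⟫}, ∀ k,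
      ⟪ξ, ν (σ ξ)⟫ - d (σ ξ) ≤ ⟪ξ, ν k⟫ - d k)
    {u : E → ℝ} (hu : ContDiff ℝ 1 u)
    (hc : HasCompactSupport u) (hsupp : tsupport u ⊆ {ξ : E | ∀ k, d k < ⟪ξ, ν k⟫}) :
    Integrable (fun ξ => u ξ ^ 2 *
      (⟪e + L ξ • f, ν (σ ξ)⟫ / (⟪ξ, ν (σ ξ)⟫ - d (σ ξ))) ^ 2) μ ∧
    1 / 4 * ∫ ξ, u ξ ^ 2 *
      (⟪e + L ξ • f, ν (σ ξ)⟫ / (⟪ξ, ν (σ ξ)⟫ - d (σ ξ))) ^ 2 ∂μ ≤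
      ∫ ξ, (fderiv ℝ u ξ (e + L ξ • f)) ^ 2 ∂μ := by
  set b : E → K → ℝ := fun ξ k => ⟪e + L ξ • f, ν k⟫ with hb
  set δ : E → K → ℝ := fun ξ k => ⟪ξ, ν k⟫ - d k with hδ
  set Ω := {ξ : E | ∀ k, d k < ⟪ξ, ν k⟫} with hΩ
  have hpos : ∀ ξ ∈ Ω, ∀ k, 0 < δ ξ k := fun ξ hξ k => sub_pos.2 (hξ k)
  have hu0 : ∀ ξ, ξ ∉ Ω → u ξ = 0 := fun ξ hξ =>
    image_eq_zero_of_notMem_tsupport fun h => hξ (hsupp h)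
  set B : E → ℝ := fun ξ => u ξ ^ 2 * (∑ k, |b ξ k| * (δ ξ k)⁻¹) ^ 2 with hB
  have hu2eq : (fun ξ => u ξ ^ 2) = u * u := by
    ext ξ
    simp [sq]
  have hBi : Integrable B μ := by
    refine Continuous.integrable_of_hasCompactSupport
      (continuous_mul_of_tsupport_subset (Ω := Ω) (hu.continuous.pow 2)
        (hu2eq ▸ tsupport_mul_subset_left.trans hsupp) fun ξ hξ => ?_)
      (HasCompactSupport.mul_right (hu2eq ▸ hc.mul_left))
    refine ContinuousAt.pow (tendsto_finsetSum _ fun k _ => ?_) 2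
    refine ContinuousAt.mul (Continuous.continuousAt ?_) (ContinuousAt.inv₀ ?_ (hpos ξ hξ k).ne')
    · exact ((continuous_const.add (L.continuous.smul continuous_const)).inner
        continuous_const).abs
    · exact ((continuous_id.inner continuous_const).sub continuous_const).continuousAt
  have hsoft := fun p : ℕ => hardy_softMin μ p ν d e f L hLe hLf hu hc hsupp
  have hbound : ∀ (p : ℕ) ξ, ‖u ξ ^ 2 * softMinLogDeriv p (b ξ) (δ ξ) ^ 2‖ ≤ B ξ := by
    intro p ξ
    by_cases hξ : ξ ∈ Ω
    · rw [Real.norm_of_nonneg (by positivity), ← sq_abs (softMinLogDeriv p _ _)]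
      exact mul_le_mul_of_nonneg_left (pow_le_pow_left₀ (abs_nonneg _)
        (abs_softMinLogDeriv_le p (b ξ) (hpos ξ hξ)) 2) (sq_nonneg _)
    · simp [hB, hu0 ξ hξ]
  have htie : ∀ᵐ ξ ∂μ, ∀ k l, ν k ≠ ν l → ⟪ξ, ν k - ν l⟫ ≠ d k - d l := by
    refine ae_all_iff.2 fun k => ae_all_iff.2 fun l => ?_
    by_cases h : ν k = ν l
    · exact Eventually.of_forall fun ξ h' => absurd h h'
    · have := measure_inner_eq_const μ (sub_ne_zero.2 h) (d k - d l)
      filter_upwards [compl_mem_ae_iff.2 this] with ξ hξ _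
      exact hξ
  have hlim : ∀ᵐ ξ ∂μ, Tendsto (fun p : ℕ => u ξ ^ 2 * softMinLogDeriv p (b ξ) (δ ξ) ^ 2) atTop
      (𝓝 (u ξ ^ 2 * (b ξ (σ ξ) / δ ξ (σ ξ)) ^ 2)) := by
    filter_upwards [htie] with ξ hξt
    by_cases hξ : ξ ∈ Ω
    · refine ((tendsto_softMinLogDeriv (b ξ) (hpos ξ hξ) (σ ξ) (hσ ξ hξ) fun k hk => ?_).pow
        2).const_mul _
      have hνk : ν k = ν (σ ξ) := by
        by_contra h
        refine hξt k (σ ξ) h ?_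
        simp only [hδ] at hk
        rw [inner_sub_right]
        linarith
      simp only [hb, hνk]
    · simp [hu0 ξ hξ]
  refine ⟨hBi.mono' (aestronglyMeasurable_of_tendsto_ae atTop
    (fun p => (hsoft p).1.aestronglyMeasurable) hlim) ?_, ?_⟩
  · filter_upwards [hlim] with ξ hξ
    exact le_of_tendsto hξ.norm (Eventually.of_forall fun p => hbound p ξ)
  · refine le_of_tendsto ((tendsto_integral_of_dominated_convergence B
      (fun p => (hsoft p).1.aestronglyMeasurable) hBi
      (fun p => Eventually.of_forall (hbound p)) hlim).const_mul (1 / 4))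
      (Eventually.of_forall fun p => (hsoft p).2)

end HardyAlongField

/-- The linear form `ξ ↦ c * ξ j`. -/
def scaledCoord {n : ℕ} (c : ℝ) (j : Fin (2 * n + 1)) : Heis n →L[ℝ] ℝ :=
  c • EuclideanSpace.proj j

lemma scaledCoord_apply {n : ℕ} (c : ℝ) (j : Fin (2 * n + 1)) (ξ : Heis n) :
    scaledCoord c j ξ = c * ξ j := rfl

lemma scaledCoord_single {n : ℕ} (c : ℝ) {j l : Fin (2 * n + 1)} (h : j ≠ l) :
    scaledCoord c j (EuclideanSpace.single l 1 : Heis n) = 0 := by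
  simp [scaledCoord_apply, h]

lemma Xd_eq_fderiv {n : ℕ} (i : Fin n) (u : Heis n → ℝ) (ξ : Heis n) :
    Xd i u ξ = fderiv ℝ u ξ (EuclideanSpace.single (xIdx i) 1 +
      scaledCoord 2 (yIdx i) ξ • EuclideanSpace.single (tIdx n) 1) := by
  simp only [map_add, map_smul, smul_eq_mul, scaledCoord_apply, Xd]

lemma Yd_eq_fderiv {n : ℕ} (i : Fin n) (u : Heis n → ℝ) (ξ : Heis n) :
    Yd i u ξ = fderiv ℝ u ξ (EuclideanSpace.single (yIdx i) 1 +
      scaledCoord (-2) (xIdx i) ξ • EuclideanSpace.single (tIdx n) 1) := by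
  simp only [map_add, map_smul, smul_eq_mul, scaledCoord_apply, Yd]
  ring

lemma XiNu_eq_inner {n : ℕ} (i : Fin n) (ξ w : Heis n) :
    XiNu i ξ w = ⟪EuclideanSpace.single (xIdx i) 1 +
      scaledCoord 2 (yIdx i) ξ • EuclideanSpace.single (tIdx n) (1 : ℝ), w⟫ := by
  simp [inner_add_left, real_inner_smul_left, EuclideanSpace.inner_single_left,
    scaledCoord_apply, XiNu]

lemma YiNu_eq_inner {n : ℕ} (i : Fin n) (ξ w : Heis n) :
    YiNu i ξ w = ⟪EuclideanSpace.single (yIdx i) 1 +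
      scaledCoord (-2) (xIdx i) ξ • EuclideanSpace.single (tIdx n) (1 : ℝ), w⟫ := by
  simp [inner_add_left, real_inner_smul_left, EuclideanSpace.inner_single_left,
    scaledCoord_apply, YiNu, sub_eq_add_neg]

/-- the polytope case of the geometric `L²` Hardy inequality. `Ω` is a
nonempty bounded open convex polytope, given as the set of points lying strictly inside
finitely many half-spaces `⟨ξ, ν k⟩ > d k` with inward unit normals `ν k` (the facets are
`F_k = ∂Ω ∩ {⟨ξ, ν k⟩ = d k}`, and for `ξ ∈ Ω` the Euclidean distance to `F_k` is
`⟨ξ, ν k⟩ − d k`). The selection `σ ξ` picks a facet nearest to `ξ`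
(so `ξ ∈ Ω_{σ ξ} = {dist(ξ, ∂Ω) = dist(ξ, F_{σ ξ})}`), and `ν (σ ξ)` plays the role of
`ν(ξ)` in the inequality. -/
theorem hardy_polytope_L2 (n : ℕ) (hn : 1 ≤ n) (K : Type) [Fintype K] [Nonempty K]
    (ν : K → Heis n) (hν : ∀ k, ‖ν k‖ = 1) (d : K → ℝ)
    (Ω : Set (Heis n)) (hΩ : Ω = {ξ : Heis n | ∀ k, d k < ⟪ξ, ν k⟫})
    (hbd : Bornology.IsBounded Ω) (hne : Ω.Nonempty)
    (σ : Heis n → K)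
    (hσ : ∀ ξ ∈ Ω, ∀ k, ⟪ξ, ν (σ ξ)⟫ - d (σ ξ) ≤ ⟪ξ, ν k⟫ - d k)
    (u : Heis n → ℝ) (hu : ContDiff ℝ (⊤ : ℕ∞) u) (hc : HasCompactSupport u)
    (hsupp : tsupport u ⊆ Ω) :
    ∫ ξ in Ω, gradH2 u ξ ≥
      (1 / 4) * ∫ ξ in Ω,
        (∑ i : Fin n, ((XiNu i ξ (ν (σ ξ))) ^ 2 + (YiNu i ξ (ν (σ ξ))) ^ 2))
          / (Metric.infDist ξ (frontier Ω)) ^ 2 * (u ξ) ^ 2 := by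
  subst hΩ
  set Ω := {ξ : Heis n | ∀ k, d k < ⟪ξ, ν k⟫} with hΩ
  have hu1 : ContDiff ℝ 1 u := hu.of_le (by exact_mod_cast le_top)
  have hX := fun i : Fin n => hardy_nearest_facet volume ν d
    (EuclideanSpace.single (xIdx i) 1) (EuclideanSpace.single (tIdx n) 1)
    (scaledCoord 2 (yIdx i))
    (scaledCoord_single 2 (by simp only [xIdx, yIdx, ne_eq, Fin.mk.injEq]; omega))
    (scaledCoord_single 2 (by simp only [tIdx, yIdx, ne_eq, Fin.mk.injEq]; omega))
    σ hσ hu1 hc hsupp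
  have hY := fun i : Fin n => hardy_nearest_facet volume ν d
    (EuclideanSpace.single (yIdx i) 1) (EuclideanSpace.single (tIdx n) 1)
    (scaledCoord (-2) (xIdx i))
    (scaledCoord_single (-2) (by simp only [xIdx, yIdx, ne_eq, Fin.mk.injEq]; omega))
    (scaledCoord_single (-2) (by simp only [tIdx, xIdx, ne_eq, Fin.mk.injEq]; omega))
    σ hσ hu1 hc hsupp
  have hXi := fun i : Fin n => integrable_fderiv_field_sq (volume : Measure (Heis n)) hu1 hc
    (EuclideanSpace.single (xIdx i) 1) (EuclideanSpace.single (tIdx n) 1)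
    (scaledCoord 2 (yIdx i))
  have hYi := fun i : Fin n => integrable_fderiv_field_sq (volume : Measure (Heis n)) hu1 hc
    (EuclideanSpace.single (yIdx i) 1) (EuclideanSpace.single (tIdx n) 1)
    (scaledCoord (-2) (xIdx i))
  simp only [← Xd_eq_fderiv, ← XiNu_eq_inner] at hX hXi
  simp only [← Yd_eq_fderiv, ← YiNu_eq_inner] at hY hYi
  have hΩm : MeasurableSet Ω := by
    rw [hΩ, Set.ofPred_forall]
    exact (isOpen_iInter_of_finite fun k =>
      isOpen_lt continuous_const (continuous_id.inner continuous_const)).measurableSet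
  have hgrad : ∫ ξ in Ω, gradH2 u ξ =
      ∑ i : Fin n, ((∫ ξ, (Xd i u ξ) ^ 2) + ∫ ξ, (Yd i u ξ) ^ 2) := by
    rw [setIntegral_eq_integral_of_forall_compl_eq_zero fun ξ hξ => ?_]
    · simp only [gradH2]
      refine (integral_finsetSum _ fun i _ => (hXi i).add (hYi i)).trans ?_
      exact Finset.sum_congr rfl fun i _ => integral_add (hXi i) (hYi i)
    · have h0 : fderiv ℝ u ξ = 0 := image_eq_zero_of_notMem_tsupport
        fun h => hξ (hsupp (tsupport_fderiv_subset ℝ h))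
      simp [gradH2, Xd, Yd, h0]
  have hweight : ∫ ξ in Ω,
        (∑ i : Fin n, ((XiNu i ξ (ν (σ ξ))) ^ 2 + (YiNu i ξ (ν (σ ξ))) ^ 2))
          / (Metric.infDist ξ (frontier Ω)) ^ 2 * (u ξ) ^ 2 =
      ∑ i : Fin n, ((∫ ξ, u ξ ^ 2 * (XiNu i ξ (ν (σ ξ)) / (⟪ξ, ν (σ ξ)⟫ - d (σ ξ))) ^ 2) +
        ∫ ξ, u ξ ^ 2 * (YiNu i ξ (ν (σ ξ)) / (⟪ξ, ν (σ ξ)⟫ - d (σ ξ))) ^ 2) := by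
    have hpt : ∀ ξ ∈ Ω, (∑ i : Fin n, ((XiNu i ξ (ν (σ ξ))) ^ 2 + (YiNu i ξ (ν (σ ξ))) ^ 2))
          / (Metric.infDist ξ (frontier Ω)) ^ 2 * (u ξ) ^ 2 =
        ∑ i : Fin n, (u ξ ^ 2 * (XiNu i ξ (ν (σ ξ)) / (⟪ξ, ν (σ ξ)⟫ - d (σ ξ))) ^ 2 +
          u ξ ^ 2 * (YiNu i ξ (ν (σ ξ)) / (⟪ξ, ν (σ ξ)⟫ - d (σ ξ))) ^ 2) := by
      intro ξ hξ
      rw [infDist_frontier_polytope hν hξ (hσ ξ hξ), Finset.sum_div, Finset.sum_mul]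
      exact Finset.sum_congr rfl fun i _ => by
        rw [div_pow, div_pow]
        ring
    rw [setIntegral_congr_fun hΩm hpt,
      setIntegral_eq_integral_of_forall_compl_eq_zero fun ξ hξ => ?_]
    · refine (integral_finsetSum _ fun i _ => (hX i).1.add (hY i).1).trans ?_
      exact Finset.sum_congr rfl fun i _ => integral_add (hX i).1 (hY i).1
    · simp [image_eq_zero_of_notMem_tsupport fun h => hξ (hsupp h)]
  rw [hgrad, hweight, ge_iff_le, Finset.mul_sum]
  refine Finset.sum_le_sum fun i _ => ?_
  rw [mul_add]
  exact add_le_add (hX i).2 (hY i).2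
end
end
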